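/- For n ≥ 1, the number of Fishburn permutations of length n avoiding the classical patterns 321 and 14253 equals 2^n − C(n,2) − 1. -/

import Mathlib

/-- A permutation `π` of `Fin n` contains the classical pattern `p` (given as a
function `Fin k → ℕ` listing the pattern's entries). -/
def Contains {n k : ℕ} (π : Equiv.Perm (Fin n)) (p : Fin k → ℕ) : Prop :=
  ∃ f : Fin k → Fin n, StrictMono f ∧ ∀ i j, p i < p j ↔ π (f i) < π (f j)

/-- Classical pattern avoidance. -/
def Avoids {n k : ℕ} (π : Equiv.Perm (Fin n)) (p : Fin k → ℕ) : Prop :=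
  ¬ Contains π p

/-- A permutation is Fishburn if there are no indices `i < j` with
`π i, π (i+1), π j` forming a 231 pattern and `π i = π j + 1`. -/
def IsFishburn {n : ℕ} (π : Equiv.Perm (Fin n)) : Prop :=
  ¬ ∃ (i j : ℕ) (hij : i + 1 < j) (hj : j < n),
      π ⟨i, by omega⟩ < π ⟨i + 1, by omega⟩ ∧
      π ⟨j, hj⟩ < π ⟨i, by omega⟩ ∧
      (π ⟨i, by omega⟩ : ℕ) = (π ⟨j, hj⟩ : ℕ) + 1

/-! ### One-line notation as a function on the naturals -/

/-- The one-line notation of a permutation of `Fin n`, extended by the identity. -/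
def oneLine {n : ℕ} (π : Equiv.Perm (Fin n)) (i : ℕ) : ℕ :=
  if h : i < n then π ⟨i, h⟩ else i

/-- `f` restricts to a permutation of `{0, …, n - 1}`. -/
structure IsPermBelow (n : ℕ) (f : ℕ → ℕ) : Prop where
  lt : ∀ i < n, f i < n
  inj : ∀ i < n, ∀ j < n, f i = f j → i = j
  surj : ∀ v < n, ∃ i < n, f i = v

/-- The Fishburn condition together with avoidance of 321 and 14253, in terms of the
one-line notation. -/
structure IsAdmissible (n : ℕ) (f : ℕ → ℕ) : Prop where
  fishburn : ∀ i j, i + 1 < j → j < n → f i < f (i + 1) → f i ≠ f j + 1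
  avoids_321 : ∀ i j k, i < j → j < k → k < n → f k < f j → ¬ f j < f i
  avoids_14253 : ∀ i j k l m, i < j → j < k → k < l → l < m → m < n →
    f i < f k → f k < f m → f m < f j → ¬ f j < f l

theorem oneLine_of_lt {n : ℕ} (π : Equiv.Perm (Fin n)) {i : ℕ} (h : i < n) :
    oneLine π i = π ⟨i, h⟩ := dif_pos h

theorem oneLine_fin {n : ℕ} (π : Equiv.Perm (Fin n)) (i : Fin n) : oneLine π i = π i :=
  oneLine_of_lt π i.2

theorem isPermBelow_oneLine {n : ℕ} (π : Equiv.Perm (Fin n)) : IsPermBelow n (oneLine π) where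
  lt i h := by rw [oneLine_of_lt π h]; exact Fin.is_lt _
  inj i hi j hj h := by
    rw [oneLine_of_lt π hi, oneLine_of_lt π hj] at h
    simpa using π.injective (Fin.ext h)
  surj v hv := ⟨π.symm ⟨v, hv⟩, Fin.is_lt _, by simp [oneLine_fin]⟩

theorem isFishburn_iff {n : ℕ} (π : Equiv.Perm (Fin n)) :
    IsFishburn π ↔ ∀ i j, i + 1 < j → j < n → oneLine π i < oneLine π (i + 1) →
      oneLine π i ≠ oneLine π j + 1 := by
  constructor
  · intro h i j hij hj h1 h2
    rw [oneLine_of_lt π (by omega)] at h1 h2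
    rw [oneLine_of_lt π (by omega)] at h1 h2
    exact h ⟨i, j, hij, hj, h1, Fin.lt_def.2 (by omega), h2⟩
  · rintro h ⟨i, j, hij, hj, h1, -, h2⟩
    refine h i j hij hj ?_ ?_
    · rwa [oneLine_of_lt π (by omega), oneLine_of_lt π (by omega)]
    · rwa [oneLine_of_lt π (by omega), oneLine_of_lt π (by omega)]

theorem avoids_321_iff {n : ℕ} (π : Equiv.Perm (Fin n)) :
    Avoids π ![3, 2, 1] ↔ ∀ i j k, i < j → j < k → k < n →
      oneLine π k < oneLine π j → ¬ oneLine π j < oneLine π i := by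
  constructor
  · intro h i j k hij hjk hk h1 h2
    rw [oneLine_of_lt π (by omega), oneLine_of_lt π (by omega)] at h1 h2
    refine h ⟨![⟨i, by omega⟩, ⟨j, by omega⟩, ⟨k, hk⟩], ?_, ?_⟩
    · rw [Fin.strictMono_iff_lt_succ]
      simp [Fin.forall_fin_succ, hij, hjk]
    · simp only [Fin.lt_def]
      simp [Fin.forall_fin_succ]
      omega
  · rintro h ⟨f, hf, hp⟩
    refine h (f 0) (f 1) (f 2) (hf (by decide)) (hf (by decide)) (f 2).2 ?_ ?_
    · rw [oneLine_fin, oneLine_fin]; exact (hp 2 1).1 (by simp)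
    · rw [oneLine_fin, oneLine_fin]; exact (hp 1 0).1 (by simp)

theorem avoids_14253_iff {n : ℕ} (π : Equiv.Perm (Fin n)) :
    Avoids π ![1, 4, 2, 5, 3] ↔ ∀ i j k l m, i < j → j < k → k < l → l < m → m < n →
      oneLine π i < oneLine π k → oneLine π k < oneLine π m → oneLine π m < oneLine π j →
      ¬ oneLine π j < oneLine π l := by
  constructor
  · intro h i j k l m hij hjk hkl hlm hm h1 h2 h3 h4
    rw [oneLine_of_lt π (by omega), oneLine_of_lt π (by omega)] at h1 h2 h3 h4
    refine h ⟨![⟨i, by omega⟩, ⟨j, by omega⟩, ⟨k, by omega⟩, ⟨l, by omega⟩, ⟨m, hm⟩], ?_, ?_⟩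
    · rw [Fin.strictMono_iff_lt_succ]
      simp [Fin.forall_fin_succ, hij, hjk, hkl, hlm]
    · simp only [Fin.lt_def]
      simp [Fin.forall_fin_succ]
      omega
  · rintro h ⟨f, hf, hp⟩
    refine h (f 0) (f 1) (f 2) (f 3) (f 4) (hf (by decide)) (hf (by decide)) (hf (by decide))
      (hf (by decide)) (f 4).2 ?_ ?_ ?_ ?_
    · rw [oneLine_fin, oneLine_fin]; exact (hp 0 2).1 (by simp)
    · rw [oneLine_fin, oneLine_fin]; exact (hp 2 4).1 (by simp)
    · rw [oneLine_fin, oneLine_fin]; exact (hp 4 1).1 (by simp)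
    · rw [oneLine_fin, oneLine_fin]; exact (hp 1 3).1 (by simp)

theorem isAdmissible_oneLine_iff {n : ℕ} (π : Equiv.Perm (Fin n)) :
    IsAdmissible n (oneLine π) ↔
      IsFishburn π ∧ Avoids π ![3, 2, 1] ∧ Avoids π ![1, 4, 2, 5, 3] := by
  rw [isFishburn_iff, avoids_321_iff, avoids_14253_iff]
  exact ⟨fun h => ⟨h.1, h.2, h.3⟩, fun h => ⟨h.1, h.2.1, h.2.2⟩⟩

theorem IsAdmissible.congr {n : ℕ} {f g : ℕ → ℕ} (hg : IsAdmissible n g)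
    (h : ∀ i < n, f i = g i) : IsAdmissible n f where
  fishburn i j hij hj := by
    rw [h i (by omega), h (i + 1) (by omega), h j hj]
    exact hg.fishburn i j hij hj
  avoids_321 i j k hij hjk hk := by
    rw [h i (by omega), h j (by omega), h k hk]
    exact hg.avoids_321 i j k hij hjk hk
  avoids_14253 i j k l m hij hjk hkl hlm hm := by
    rw [h i (by omega), h j (by omega), h k (by omega), h l (by omega), h m hm]
    exact hg.avoids_14253 i j k l m hij hjk hkl hlm hm

/-- Permutations satisfying `P` can be counted through codes `S ∈ C` of their one-line
notation `φ S`. -/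
theorem ncard_perm_eq_card {n : ℕ} {α : Type*} (P : (ℕ → ℕ) → Prop) (C : Finset α)
    (φ : α → ℕ → ℕ)
    (hP : ∀ f g : ℕ → ℕ, (∀ i < n, f i = g i) → P g → P f)
    (lt : ∀ S ∈ C, ∀ i < n, φ S i < n)
    (inj : ∀ S ∈ C, ∀ i < n, ∀ j < n, φ S i = φ S j → i = j)
    (sound : ∀ S ∈ C, P (φ S))
    (complete : ∀ f, IsPermBelow n f → P f → ∃ S ∈ C, ∀ i < n, f i = φ S i)
    (unique : ∀ S ∈ C, ∀ T ∈ C, (∀ i < n, φ S i = φ T i) → S = T) :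
    {π : Equiv.Perm (Fin n) | P (oneLine π)}.ncard = C.card := by
  have key : ∀ S ∈ C, ∃ π : Equiv.Perm (Fin n), ∀ i < n, oneLine π i = φ S i := by
    intro S hS
    have hinj : Function.Injective (fun i : Fin n => (⟨φ S i, lt S hS i i.2⟩ : Fin n)) := by
      intro i j h
      exact Fin.ext (inj S hS i i.2 j j.2 (by simpa using h))
    refine ⟨Equiv.ofBijective _ (Finite.injective_iff_bijective.1 hinj), fun i hi => ?_⟩
    rw [oneLine_of_lt _ hi]
    rfl
  choose F hF using key
  symm
  rw [← Set.ncard_coe_finset]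
  refine Set.ncard_congr F ?_ ?_ ?_
  · intro S hS
    exact hP _ _ (hF S hS) (sound S hS)
  · intro S T hS hT h
    refine unique S hS T hT fun i hi => ?_
    rw [← hF S hS i hi, ← hF T hT i hi, h]
  · intro π hπ
    obtain ⟨S, hS, h⟩ := complete _ (isPermBelow_oneLine π) hπ
    refine ⟨S, hS, Equiv.ext fun i => Fin.ext ?_⟩
    rw [← oneLine_fin, ← oneLine_fin, hF S hS i i.2, h i i.2]

/-! ### Layered and twisted functions -/

/-- The least element of `S` exceeding `i`, or `n` if there is none. -/
noncomputable def nextIn (n : ℕ) (S : Finset ℕ) (i : ℕ) : ℕ :=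
  sInf {j | i < j ∧ (j ∈ S ∨ n ≤ j)}

theorem nextIn_spec {n : ℕ} {S : Finset ℕ} {i : ℕ} (hi : i < n) :
    i < nextIn n S i ∧ nextIn n S i ≤ n ∧ (nextIn n S i ∈ S ∨ nextIn n S i = n) ∧
      ∀ j, i < j → j < nextIn n S i → j ∉ S := by
  have hn : n ∈ {j | i < j ∧ (j ∈ S ∨ n ≤ j)} := ⟨hi, Or.inr le_rfl⟩
  have hm := Nat.sInf_mem ⟨n, hn⟩
  have hle : nextIn n S i ≤ n := Nat.sInf_le hn
  refine ⟨hm.1, hle, hm.2.imp_right fun h => le_antisymm hle h, fun j hij hj hjS => ?_⟩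
  exact absurd (Nat.sInf_le (show j ∈ {j | i < j ∧ (j ∈ S ∨ n ≤ j)} from ⟨hij, Or.inl hjS⟩))
    (not_le.2 hj)

theorem nextIn_eq {n : ℕ} {S : Finset ℕ} {i m : ℕ} (him : i < m) (hmn : m ≤ n)
    (hm : m ∈ S ∨ m = n) (h : ∀ j, i < j → j < m → j ∉ S) : nextIn n S i = m := by
  obtain ⟨h1, h2, h3, h4⟩ := nextIn_spec (S := S) (him.trans_le hmn)
  rcases lt_trichotomy (nextIn n S i) m with hlt | heq | hgt
  · rcases h3 with h3 | h3
    · exact absurd h3 (h _ h1 hlt)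
    · omega
  · exact heq
  · rcases hm with hm | hm
    · exact absurd hm (h4 _ him hgt)
    · omega

/-- The direct sum of the permutations `k 1 2 ⋯ (k - 1)`, where the positions are counted
from `0` and the summands start at `0` and at the elements of `S`. -/
noncomputable def layered (n : ℕ) (S : Finset ℕ) (i : ℕ) : ℕ :=
  if i = 0 ∨ i ∈ S then nextIn n S i - 1 else i - 1

/-- If `a < b < c` are the least elements of `S` and `N` is the next one, the direct sum of
`b, 0, …, a - 1, b + 1, …, c - 1, N - 1, a, …, b - 1, c, …, N - 2` and
the layered summands starting at the elements of `S` from `N` on. -/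
noncomputable def twisted (n : ℕ) (S : Finset ℕ) (i : ℕ) : ℕ :=
  let a := nextIn n S 0
  let b := nextIn n S a
  let c := nextIn n S b
  if i = 0 then b
  else if i ≤ a then i - 1
  else if i < a + c - b then i + b - a
  else if i = a + c - b then nextIn n S c - 1
  else if i ≤ c then i + b - c - 1
  else layered n S i

theorem layered_cases {n : ℕ} (S : Finset ℕ) {i : ℕ} (hi : i < n) :
    (i ∉ S ∧ 0 < i ∧ layered n S i = i - 1) ∨
    ((i = 0 ∨ i ∈ S) ∧ i ≤ layered n S i ∧ layered n S i < n ∧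
      (layered n S i + 1 ∈ S ∨ layered n S i + 1 = n) ∧
      ∀ j, i < j → j ≤ layered n S i → j ∉ S) := by
  obtain ⟨h1, h2, h3, h4⟩ := nextIn_spec (S := S) hi
  unfold layered
  split_ifs with h
  · right
    have : nextIn n S i - 1 + 1 = nextIn n S i := by omega
    rw [this]
    exact ⟨h, by omega, by omega, h3, fun j hj hj' => h4 j hj (by omega)⟩
  · left
    rw [not_or] at h
    exact ⟨h.2, by omega, rfl⟩

theorem layered_lt {n : ℕ} (S : Finset ℕ) {i : ℕ} (hi : i < n) : layered n S i < n := by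
  rcases layered_cases S hi with h | h <;> omega

theorem le_layered_add_one {n : ℕ} (S : Finset ℕ) {i : ℕ} (hi : i < n) :
    i ≤ layered n S i + 1 := by
  rcases layered_cases S hi with h | h <;> omega

theorem layered_injOn {n : ℕ} {S : Finset ℕ} {i j : ℕ} (hi : i < n)
    (hj : j < n) (h : layered n S i = layered n S j) : i = j := by
  by_contra hne
  wlog hij : i < j generalizing i j
  · exact this hj hi h.symm (Ne.symm hne) (by omega)
  rcases layered_cases S hi with h1 | h1 <;> rcases layered_cases S hj with h2 | h2
  · omega
  · omega
  · have : layered n S i + 1 = j := by omega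
    grind
  · grind

/-- The inversions of a layered function lie within one summand. -/
theorem layered_inversion {n : ℕ} {S : Finset ℕ} {i j : ℕ} (hij : i < j) (hj : j < n)
    (h : layered n S j < layered n S i) :
    i ≤ layered n S i ∧ j ≤ layered n S i ∧
      ∀ k, i < k → k ≤ layered n S i → layered n S k = k - 1 := by
  have hi : i < n := hij.trans hj
  rcases layered_cases S hi with h1 | h1
  · rcases layered_cases S hj with h2 | h2 <;> omega
  · refine ⟨h1.2.1, ?_, ?_⟩
    · rcases layered_cases S hj with h2 | h2 <;> omega
    · intro k hk hk'
      rcases layered_cases S (show k < n by omega) with h3 | h3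
      · exact h3.2.2
      · grind

theorem isAdmissible_layered (n : ℕ) (S : Finset ℕ) : IsAdmissible n (layered n S) where
  fishburn i j hij hj h1 h2 := by
    have := layered_inversion (S := S) (i := i) (by omega) hj (by omega)
    have := this.2.2 (i + 1) (by omega) (by omega)
    omega
  avoids_321 i j k hij hjk hk h1 h2 := by
    have h3 := layered_inversion (S := S) hij (by omega) h2
    have h4 := layered_inversion (S := S) hjk hk h1
    have := h3.2.2 j (by omega) (by omega)
    omega
  avoids_14253 i j k l m hij hjk hkl hlm hm h1 h2 h3 h4 := by
    have h5 := layered_inversion (S := S) (i := j) (by omega) hm h3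
    have := h5.2.2 l (by omega) (by omega)
    omega

namespace IsPermBelow

variable {n : ℕ} {f : ℕ → ℕ}

theorem lt_of_forall_le (hf : IsPermBelow n f) {j : ℕ} (hj : j ≤ n)
    (h : ∀ l, j ≤ l → l < n → j ≤ f l) {i : ℕ} (hi : i < j) : f i < j := by
  by_contra! hji
  have hcard := Finset.card_le_card_of_injOn (s := insert i (Finset.Ico j n))
    (t := Finset.Ico j n) f ?_ ?_
  · rw [Finset.card_insert_of_notMem (by simp; omega)] at hcard
    omega
  · intro l hl
    have := hf.lt l
    simp only [Finset.coe_insert, Finset.coe_Ico, Set.mem_insert_iff, Set.mem_Ico] at hl ⊢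
    rcases hl with rfl | hl
    · exact ⟨hji, this (by omega)⟩
    · exact ⟨h l hl.1 hl.2, this hl.2⟩
  · intro l hl k hk
    simp only [Finset.coe_insert, Finset.coe_Ico, Set.mem_insert_iff, Set.mem_Ico] at hl hk
    exact hf.inj l (by omega) k (by omega)

theorem exists_two_larger (hf : IsPermBelow n f) {i : ℕ} (hi : i < n) (h : f i + 1 < i) :
    ∃ p q, p < q ∧ q < i ∧ f i < f p ∧ f i < f q := by
  have hsmall : ((Finset.range i).filter fun l => ¬ f i < f l).card ≤ f i := by
    refine (Finset.card_le_card_of_injOn (t := Finset.range (f i)) f ?_ ?_).trans_eq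
      (Finset.card_range _)
    · intro l hl
      simp only [Finset.coe_filter, Finset.mem_range, Set.mem_ofPred_eq, Finset.coe_range,
        Set.mem_Iio] at hl ⊢
      have := hf.inj l (by omega) i hi
      omega
    · intro l hl k hk
      simp only [Finset.coe_filter, Finset.mem_range, Set.mem_ofPred_eq] at hl hk
      exact hf.inj l (by omega) k (by omega)
  have hsum := Finset.card_filter_add_card_filter_not (s := Finset.range i) (fun l => f i < f l)
  rw [Finset.card_range] at hsum
  obtain ⟨p, hp, q, hq, hpq⟩ := Finset.one_lt_card.1
    (show 1 < ((Finset.range i).filter fun l => f i < f l).card by omega)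
  simp only [Finset.mem_filter, Finset.mem_range] at hp hq
  rcases lt_or_gt_of_ne hpq with h | h
  · exact ⟨p, q, h, hq.1, hp.2, hq.2⟩
  · exact ⟨q, p, h, hp.1, hq.2, hp.2⟩

theorem eq_layered (hf : IsPermBelow n f) {N : ℕ} {S : Finset ℕ}
    (hlow : ∀ i, N ≤ i → i < n → i ≤ f i + 1)
    (hS : ∀ i, N ≤ i → i < n → i ≠ 0 → (i ∈ S ↔ i ≤ f i)) :
    ∀ i, N ≤ i → i < n → f i = layered n S i := by
  intro i hNi hi
  have hi1 := hlow i hNi hi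
  have hi2 := hS i hNi hi
  unfold layered
  split_ifs with h
  · have hif : i ≤ f i := by
      rcases h with rfl | h
      · omega
      · by_cases h0 : i = 0
        · omega
        · exact (hi2 h0).1 h
    obtain ⟨h1, h2, h3, h4⟩ := nextIn_spec (S := S) hi
    set m := nextIn n S i
    have hlt : f i < m := by
      refine hf.lt_of_forall_le h2 (fun l hml hl => ?_) h1
      have := hlow l (by omega) hl
      rcases hml.eq_or_lt with rfl | hml
      · exact (hS m (by omega) hl (by omega)).1 (h3.resolve_right (by omega))
      · omega
    by_contra hne
    have h5 := h4 (f i + 1) (by omega) (by omega)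
    rw [hS _ (by omega) (by omega) (by omega)] at h5
    have h6 := hlow (f i + 1) (by omega) (by omega)
    have := hf.inj i hi (f i + 1) (by omega) (by omega)
    omega
  · rw [not_or] at h
    have := (hi2 h.1).not.1 h.2
    omega

end IsPermBelow

theorem ncard_layered (n : ℕ) :
    {π : Equiv.Perm (Fin n) | IsAdmissible n (oneLine π) ∧
      ∀ i < n, i ≤ oneLine π i + 1}.ncard = 2 ^ (n - 1) := by
  rw [ncard_perm_eq_card (fun f => IsAdmissible n f ∧ ∀ i < n, i ≤ f i + 1)
    (Finset.Ioo 0 n).powerset (layered n)]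
  · simp
  · rintro f g h ⟨hg, hg'⟩
    exact ⟨hg.congr h, fun i hi => by rw [h i hi]; exact hg' i hi⟩
  · intro S _ i
    exact layered_lt S
  · intro S _ i hi j
    exact layered_injOn hi
  · intro S _
    exact ⟨isAdmissible_layered n S, fun i => le_layered_add_one S⟩
  · rintro f hf ⟨-, hlow⟩
    refine ⟨(Finset.Ioo 0 n).filter fun i => i ≤ f i, ?_, fun i hi => ?_⟩
    · simp
    · refine hf.eq_layered (fun i _ => hlow i) (fun i _ hi h0 => ?_) i (Nat.zero_le i) hi
      simp
      omega
  · intro S hS T hT h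
    have mem_iff : ∀ S ∈ (Finset.Ioo 0 n).powerset, ∀ i,
        i ∈ S ↔ 0 < i ∧ i < n ∧ i ≤ layered n S i := by
      intro S hS i
      have := fun h : i ∈ S => Finset.mem_Ioo.1 (Finset.mem_powerset.1 hS h)
      by_cases hi : i < n
      · rcases layered_cases S hi with h | h <;> grind
      · grind
    ext i
    rw [mem_iff S hS, mem_iff T hT]
    grind

/-- If an admissible permutation contains a 231 pattern, then its second entry is `0`, its first
entry starts a 231 pattern, and the first entry exceeds the least entry of every 231 pattern. -/
theorem IsAdmissible.of_231 {n : ℕ} {f : ℕ → ℕ} (hf : IsPermBelow n f) (h : IsAdmissible n f) :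
    ∀ p q r, p < q → q < r → r < n → f r < f p → f p < f q →
      f r < f 0 ∧ f 1 = 0 ∧ ∃ s t, 1 < s ∧ s < t ∧ t < n ∧ f 0 = f t + 1 ∧ f 0 < f s := by
  intro p q r
  induction hd : f p - f r using Nat.strong_induction_on generalizing p r with
  | _ d ih =>
  intro hpq hqr hr hrp hpq'
  obtain ⟨x, hx, hfx⟩ := hf.surj (f p - 1) (by have := hf.lt p (by omega); omega)
  by_cases hxr : x = r
  · subst hxr
    have hp1 : f (p + 1) < f x := by
      have h1 := h.fishburn p x (by omega) hr
      have h2 := hf.inj p (by omega) (p + 1) (by omega)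
      have h3 := hf.inj x (by omega) (p + 1) (by omega)
      omega
    have hq1 : q ≠ p + 1 := by rintro rfl; omega
    have between : ∀ t < p, f (p + 1) < f t ∧ f t < f p := by
      intro t ht
      have h1 := h.avoids_14253 t p (p + 1) q x
      have h2 := h.avoids_321 t p x
      have h3 := hf.inj t (by omega) p (by omega)
      have h4 := hf.inj t (by omega) (p + 1) (by omega)
      omega
    have hp0 : p = 0 := by
      by_contra hp0
      have hb := between 0 (by omega)
      obtain ⟨u, hu, hfu⟩ := hf.surj (f 0 - 1) (by have := hf.lt 0 (by omega); omega)
      have incr : ∀ t, 0 < t → t ≤ p → f 0 < f t := by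
        intro t ht htp
        have h1 := h.avoids_321 0 t (p + 1)
        have h2 := hf.inj 0 (by omega) t (by omega)
        rcases htp.eq_or_lt with rfl | htp
        · exact hb.2
        · have := between t htp
          omega
      have h0 : u ≠ 0 := by rintro rfl; omega
      have hup : p < u := by
        by_contra hup
        have := incr u (by omega) (by omega)
        omega
      have := h.fishburn 0 u (by omega) hu (incr 1 (by omega) (by omega))
      omega
    subst hp0
    refine ⟨hrp, ?_, q, x, by omega, hqr, hr, by omega, hpq'⟩
    obtain ⟨u, hu, hfu⟩ := hf.surj 0 (by omega)
    by_contra h10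
    rw [zero_add] at hp1
    have h0 : u ≠ 0 := by rintro rfl; omega
    have h1 : u ≠ 1 := by rintro rfl; omega
    have := h.avoids_321 0 1 u
    omega
  · have hne := hf.inj x hx r hr
    have hxp : x ≠ p := by rintro rfl; omega
    have hxq : x ≠ q := by rintro rfl; omega
    have h3 := h.avoids_321 p x r
    rcases lt_or_gt_of_ne hxp with h1 | h1
    · exact ih _ (by omega) x r rfl (by omega) hqr hr (by omega) (by omega)
    · have := ih _ (by omega) p x rfl hpq (by omega) hx (by omega) hpq'
      exact ⟨by omega, this.2⟩

/-- `S ⊆ {1, …, n - 1}` has at least three elements, the least ones being `a < b < c`. -/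
structure StartsWith (n : ℕ) (S : Finset ℕ) (a b c : ℕ) : Prop where
  subset : S ⊆ Finset.Ioo 0 n
  pos : 0 < a
  lt₁ : a < b
  lt₂ : b < c
  lt₃ : c < n
  mem_iff : ∀ i ≤ c, i ∈ S ↔ i = a ∨ i = b ∨ i = c

namespace StartsWith

variable {n a b c : ℕ} {S : Finset ℕ}

theorem nextIn_zero (h : StartsWith n S a b c) : nextIn n S 0 = a := by
  have := h.lt₁; have := h.lt₂; have := h.lt₃
  refine nextIn_eq h.pos (by omega) (Or.inl ((h.mem_iff a (by omega)).2 (by omega))) ?_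
  intro j _ _
  rw [h.mem_iff j (by omega)]
  omega

theorem nextIn_first (h : StartsWith n S a b c) : nextIn n S a = b := by
  have := h.lt₁; have := h.lt₂; have := h.lt₃
  refine nextIn_eq h.lt₁ (by omega) (Or.inl ((h.mem_iff b (by omega)).2 (by omega))) ?_
  intro j _ _
  rw [h.mem_iff j (by omega)]
  omega

theorem nextIn_second (h : StartsWith n S a b c) : nextIn n S b = c := by
  have := h.lt₁; have := h.lt₂; have := h.lt₃
  refine nextIn_eq h.lt₂ (by omega) (Or.inl ((h.mem_iff c (by omega)).2 (by omega))) ?_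
  intro j _ _
  rw [h.mem_iff j (by omega)]
  omega

theorem twisted_eq (h : StartsWith n S a b c) (i : ℕ) :
    twisted n S i = if i = 0 then b
      else if i ≤ a then i - 1
      else if i < a + c - b then i + b - a
      else if i = a + c - b then nextIn n S c - 1
      else if i ≤ c then i + b - c - 1
      else layered n S i := by
  simp only [twisted, h.nextIn_zero, h.nextIn_first, h.nextIn_second]

theorem layered_tail (h : StartsWith n S a b c) {i : ℕ} (hci : c < i) (hi : i < n) :
    i < nextIn n S c ∧ layered n S i = i - 1 ∨
      nextIn n S c ≤ i ∧ nextIn n S c ≤ layered n S i := by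
  obtain ⟨h1, h2, h3, h4⟩ := nextIn_spec (S := S) h.lt₃
  rcases layered_cases S hi with h5 | h5
  · have : i ≠ nextIn n S c := by
      rintro rfl
      rcases h3 with h3 | h3
      · exact h5.1 h3
      · omega
    omega
  · have : nextIn n S c ≤ i := by
      by_contra! hlt
      exact h4 i hci hlt (h5.1.resolve_left (by omega))
    omega

theorem twisted_cases (h : StartsWith n S a b c) {i : ℕ} (hi : i < n) :
    i = 0 ∧ twisted n S i = b ∨
    0 < i ∧ i ≤ a ∧ twisted n S i = i - 1 ∨
    a < i ∧ i < a + c - b ∧ twisted n S i = i + b - a ∨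
    i = a + c - b ∧ twisted n S i = nextIn n S c - 1 ∨
    a + c - b < i ∧ i ≤ c ∧ twisted n S i = i + b - c - 1 ∨
    c < i ∧ i < nextIn n S c ∧ twisted n S i = i - 1 ∨
    c < i ∧ nextIn n S c ≤ i ∧ twisted n S i = layered n S i ∧
      nextIn n S c ≤ twisted n S i := by
  have h₁ := h.lt₁; have h₂ := h.lt₂
  rw [h.twisted_eq]
  split_ifs with c1 c2 c3 c4 c5
  · exact Or.inl ⟨c1, rfl⟩
  · exact Or.inr (Or.inl ⟨by omega, c2, rfl⟩)
  · exact Or.inr (Or.inr (Or.inl ⟨by omega, c3, rfl⟩))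
  · exact Or.inr (Or.inr (Or.inr (Or.inl ⟨c4, rfl⟩)))
  · exact Or.inr (Or.inr (Or.inr (Or.inr (Or.inl ⟨by omega, c5, rfl⟩))))
  · refine Or.inr (Or.inr (Or.inr (Or.inr (Or.inr ?_))))
    have := h.layered_tail (i := i) (by omega) hi
    omega

theorem lt_nextIn (h : StartsWith n S a b c) : c < nextIn n S c := (nextIn_spec h.lt₃).1

theorem nextIn_le (h : StartsWith n S a b c) : nextIn n S c ≤ n := (nextIn_spec h.lt₃).2.1

theorem twisted_lt (h : StartsWith n S a b c) {i : ℕ} (hi : i < n) : twisted n S i < n := by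
  have := h.lt₁; have := h.lt₂; have := h.lt₃; have := h.nextIn_le
  have := layered_lt S hi
  rcases h.twisted_cases hi with h | h | h | h | h | h | h <;> omega

theorem twisted_injOn (h : StartsWith n S a b c) {i j : ℕ} (hi : i < n) (hj : j < n)
    (hij : twisted n S i = twisted n S j) : i = j := by
  have := h.pos; have := h.lt₁; have := h.lt₂; have := h.lt₃; have := h.lt_nextIn
  have := layered_injOn (S := S) hi hj
  have := h.layered_tail (i := i)
  have := h.layered_tail (i := j)
  rcases h.twisted_cases hi with h1 | h1 | h1 | h1 | h1 | h1 | h1 <;>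
  rcases h.twisted_cases hj with h2 | h2 | h2 | h2 | h2 | h2 | h2 <;> omega

theorem twisted_inversion (h : StartsWith n S a b c) {i j : ℕ} (hij : i < j) (hj : j < n)
    (hlt : twisted n S j < twisted n S i) :
    i = 0 ∧ (j ≤ a ∨ a + c - b < j ∧ j ≤ c) ∨
    a < i ∧ i < a + c - b ∧ a + c - b < j ∧ j ≤ c ∨
    i = a + c - b ∧ j < nextIn n S c ∨
    nextIn n S c ≤ i := by
  have := h.pos; have := h.lt₁; have := h.lt₂; have := h.lt₃; have := h.lt_nextIn
  rcases h.twisted_cases (hij.trans hj) with h1 | h1 | h1 | h1 | h1 | h1 | h1 <;>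
  rcases h.twisted_cases hj with h2 | h2 | h2 | h2 | h2 | h2 | h2 <;> omega

theorem twisted_of_le (h : StartsWith n S a b c) {i : ℕ} (hi : nextIn n S c ≤ i) :
    twisted n S i = layered n S i := by
  have := h.lt₁; have := h.lt₂; have := h.lt_nextIn; have := h.pos
  rw [h.twisted_eq]
  split_ifs <;> first | rfl | omega

theorem isAdmissible_twisted (h : StartsWith n S a b c) : IsAdmissible n (twisted n S) := by
  have hp := h.pos; have h₁ := h.lt₁; have h₂ := h.lt₂; have h₃ := h.lt₃; have hN := h.lt_nextIn
  have hL := isAdmissible_layered n S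
  refine ⟨fun i j hij hj hlt heq => ?_, fun i j k hij hjk hk hkj hji => ?_,
    fun i j k l m hij hjk hkl hlm hm h1 h2 h3 h4 => ?_⟩
  · by_cases hi : nextIn n S c ≤ i
    · rw [h.twisted_of_le hi, h.twisted_of_le (by omega)] at hlt heq
      exact hL.fishburn i j hij hj hlt heq
    · have hinv := h.twisted_inversion (i := i) (by omega) hj (by omega)
      rcases h.twisted_cases (show i < n by omega) with h1 | h1 | h1 | h1 | h1 | h1 | h1 <;>
      rcases h.twisted_cases (show i + 1 < n by omega) with
        h2 | h2 | h2 | h2 | h2 | h2 | h2 <;> try omega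
      all_goals rcases h.twisted_cases hj with h3 | h3 | h3 | h3 | h3 | h3 | h3 <;> omega
  · by_cases hi : nextIn n S c ≤ i
    · rw [h.twisted_of_le hi, h.twisted_of_le (by omega)] at hji
      rw [h.twisted_of_le (by omega), h.twisted_of_le (by omega)] at hkj
      exact hL.avoids_321 i j k hij hjk hk hkj hji
    · have := h.twisted_inversion hij (by omega) hji
      have := h.twisted_inversion hjk hk hkj
      omega
  · by_cases hi : nextIn n S c ≤ j
    · rw [h.twisted_of_le (by omega), h.twisted_of_le (by omega)] at h2 h3 h4
      have h5 := layered_inversion (S := S) (i := j) (by omega) hm h3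
      have := h5.2.2 l (by omega) (by omega)
      omega
    · have := h.twisted_inversion (i := j) (by omega) hm h3
      have := h.twisted_inversion (i := j) (j := k) (by omega) (by omega) (by omega)
      rcases h.twisted_cases (show j < n by omega) with h1 | h1 | h1 | h1 | h1 | h1 | h1 <;>
      rcases h.twisted_cases (show l < n by omega) with
        h2 | h2 | h2 | h2 | h2 | h2 | h2 <;> omega

theorem exists_not_layered (h : StartsWith n S a b c) : ∃ i < n, ¬ i ≤ twisted n S i + 1 := by
  have := h.pos; have := h.lt₁; have := h.lt₂; have := h.lt₃
  refine ⟨c, by omega, ?_⟩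
  rw [h.twisted_eq]
  split_ifs <;> omega

theorem mem_iff_twisted (h : StartsWith n S a b c) (i : ℕ) :
    i ∈ S ↔ i = a ∨ i = b ∨ i = c ∨ c < i ∧ i < n ∧ i ≤ twisted n S i := by
  have := h.pos; have := h.lt₁; have := h.lt₂; have := h.lt₃
  by_cases hic : i ≤ c
  · rw [h.mem_iff i hic]
    omega
  · by_cases hi : i < n
    · have : twisted n S i = layered n S i := by
        rw [h.twisted_eq]
        split_ifs <;> first | rfl | omega
      rw [this]
      rcases layered_cases S hi with h1 | h1
      · simp only [h1.1, false_iff]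
        omega
      · simp only [h1.1.resolve_left (by omega), true_iff]
        omega
    · refine iff_of_false (fun hS => hi (Finset.mem_Ioo.1 (h.subset hS)).2) ?_
      omega

theorem eq_of_twisted_eq (h : StartsWith n S a b c) {T : Finset ℕ} {a' b' c' : ℕ}
    (h' : StartsWith n T a' b' c') (heq : ∀ i < n, twisted n S i = twisted n T i) : S = T := by
  have hp := h.pos; have h₁ := h.lt₁; have h₂ := h.lt₂; have h₃ := h.lt₃; have hN := h.lt_nextIn
  have hp' := h'.pos; have h₁' := h'.lt₁; have h₂' := h'.lt₂; have h₃' := h'.lt₃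
  have hN' := h'.lt_nextIn
  have hb : b = b' := by
    have h0 := heq 0 (by omega)
    rw [h.twisted_eq, h'.twisted_eq] at h0
    rwa [if_pos rfl, if_pos rfl] at h0
  subst hb
  have ha : a = a' := by
    rcases lt_trichotomy a a' with hlt | heq' | hlt
    · have h1 := heq (a + 1) (by omega)
      have := h.twisted_cases (show a + 1 < n by omega)
      have := h'.twisted_cases (show a + 1 < n by omega)
      omega
    · exact heq'
    · have h1 := heq (a' + 1) (by omega)
      have := h.twisted_cases (show a' + 1 < n by omega)
      have := h'.twisted_cases (show a' + 1 < n by omega)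
      omega
  subst ha
  have hc : c = c' := by
    rcases lt_trichotomy c c' with hlt | heq' | hlt
    · have h1 := heq (a + c - b + 1) (by omega)
      have := h.twisted_cases (show a + c - b + 1 < n by omega)
      have := h'.twisted_cases (show a + c - b + 1 < n by omega)
      omega
    · exact heq'
    · have h1 := heq (a + c' - b + 1) (by omega)
      have := h.twisted_cases (show a + c' - b + 1 < n by omega)
      have := h'.twisted_cases (show a + c' - b + 1 < n by omega)
      omega
  subst hc
  ext i
  rw [h.mem_iff_twisted, h'.mem_iff_twisted]
  by_cases hi : i < n
  · rw [heq i hi]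
  · omega

theorem of_card {n : ℕ} {S : Finset ℕ} (hS : S ⊆ Finset.Ioo 0 n) (h : 3 ≤ S.card) :
    ∃ a b c, StartsWith n S a b c := by
  have hS' : ∀ i ∈ S, 0 < i ∧ i < n := fun i hi => Finset.mem_Ioo.1 (hS hi)
  have hn : 0 < n := by
    obtain ⟨i, hi⟩ := Finset.card_pos.1 (show 0 < S.card by omega)
    have := hS' i hi
    omega
  obtain ⟨a1, a2, a3, a4⟩ := nextIn_spec (S := S) hn
  set a := nextIn n S 0
  have ha : a < n := by
    by_contra! han
    have : S ⊆ ∅ := fun i hi => absurd hi (a4 i (hS' i hi).1 (by have := hS' i hi; omega))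
    have := (Finset.card_le_card this).trans_eq Finset.card_empty
    omega
  obtain ⟨b1, b2, b3, b4⟩ := nextIn_spec (S := S) ha
  set b := nextIn n S a
  have hb : b < n := by
    by_contra! hbn
    have : S ⊆ {a} := by
      intro i hi
      have := hS' i hi
      have := a4 i
      have := b4 i
      grind
    have := (Finset.card_le_card this).trans_eq (Finset.card_singleton a)
    omega
  obtain ⟨c1, c2, c3, c4⟩ := nextIn_spec (S := S) hb
  set c := nextIn n S b
  have hc : c < n := by
    by_contra! hcn
    have : S ⊆ {a, b} := by
      intro i hi
      have := hS' i hi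
      have := a4 i
      have := b4 i
      have := c4 i
      grind
    have := (Finset.card_le_card this).trans Finset.card_le_two
    omega
  refine ⟨a, b, c, hS, a1, b1, c1, hc, fun i hi => ⟨fun h => ?_, ?_⟩⟩
  · have := hS' i h
    have := a4 i
    have := b4 i
    have := c4 i
    grind
  · rintro (rfl | rfl | rfl)
    · exact a3.resolve_right ha.ne
    · exact b3.resolve_right hb.ne
    · exact c3.resolve_right hc.ne

theorem three_le_card (h : StartsWith n S a b c) : 3 ≤ S.card := by
  have := h.lt₁; have := h.lt₂
  rw [← Finset.card_eq_three.2 ⟨a, b, c, by omega, by omega, by omega, rfl⟩]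
  refine Finset.card_le_card fun i hi => ?_
  simp only [Finset.mem_insert, Finset.mem_singleton] at hi
  exact (h.mem_iff i (by omega)).2 hi

end StartsWith

theorem IsAdmissible.exists_eq_twisted {n : ℕ} {f : ℕ → ℕ} (hf : IsPermBelow n f)
    (h : IsAdmissible n f) {i : ℕ} (hi : i < n) (hfi : f i + 1 < i) :
    ∃ S a b c, StartsWith n S a b c ∧ ∀ i < n, f i = twisted n S i := by
  have inj : ∀ {i j}, i < n → j < n → f i = f j → i = j := fun hi hj => hf.inj _ hi _ hj
  have key : ∀ i < n, f i + 1 < i →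
      f i < f 0 ∧ f 1 = 0 ∧ ∃ s t, 1 < s ∧ s < t ∧ t < n ∧ f 0 = f t + 1 ∧ f 0 < f s := by
    intro i hi hfi
    obtain ⟨p, q, hpq, hqi, hp, hq⟩ := hf.exists_two_larger hi hfi
    have h1 := h.avoids_321 p q i hpq hqi hi hq
    have h2 := hf.inj p (by omega) q (by omega)
    exact h.of_231 hf p q i hpq hqi hi hp (by omega)
  obtain ⟨-, hf1, s₀, t, hs₀, hst, ht, hft, hfs₀⟩ := key i hi hfi
  have hn0 : 0 < n := by omega
  obtain ⟨b, hb⟩ : ∃ b, b = f 0 := ⟨_, rfl⟩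
  have hbn : b < n := hb ▸ hf.lt 0 hn0
  rw [← hb] at hft hfs₀
  -- `s` is the first position after `0` with a large value
  obtain ⟨s, ⟨hs1, hfs⟩, hsmin⟩ : ∃ s, (0 < s ∧ b < f s) ∧ ∀ l < s, ¬ (0 < l ∧ b < f l) := by
    have hex : ∃ s, 0 < s ∧ b < f s := ⟨s₀, by omega, hfs₀⟩
    exact ⟨Nat.find hex, Nat.find_spec hex, fun l hl => Nat.find_min hex hl⟩
  have hss₀ : s ≤ s₀ := by
    by_contra! hlt
    exact hsmin s₀ hlt ⟨by omega, hfs₀⟩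
  have hs2 : s ≠ 1 := by rintro rfl; omega
  have small : ∀ l, 0 < l → l < s → f l = l - 1 := by
    intro l
    induction l using Nat.strong_induction_on with
    | _ l ih =>
    intro hl hls
    have hlb : f l < b := by
      have := hsmin l hls
      have := hf.inj l (by omega) 0 hn0
      omega
    have hle : l - 1 ≤ f l := by
      by_contra! hlt
      have := ih (f l + 1) (by omega) (by omega) (by omega)
      have := hf.inj l (by omega) (f l + 1) (by omega)
      omega
    obtain ⟨u, hu, hfu⟩ := hf.surj (l - 1) (by omega)
    rcases lt_trichotomy u l with hul | rfl | hul
    · rcases Nat.eq_zero_or_pos u with rfl | hu0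
      · omega
      · have := ih u hul hu0 (by omega)
        omega
    · exact hfu
    · have := h.avoids_321 0 l u hl hul hu
      have := hf.inj l (by omega) u hu
      omega
  obtain ⟨a, rfl⟩ : ∃ a, s = a + 1 := ⟨s - 1, by omega⟩
  have hab : a < b := by
    have h1 := small a (by omega) (by omega)
    have h2 := hsmin a
    have h3 := hf.inj a (by omega) 0 hn0
    have h4 := hf.inj a (by omega) t ht
    omega
  have pos_of_lt : ∀ l < n, f l < a → l = f l + 1 := by
    intro l hl hla
    have := small (f l + 1) (by omega) (by omega)
    exact hf.inj l hl (f l + 1) (by omega) (by omega)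
  obtain ⟨w, hw, hfw⟩ := hf.surj a (by omega)
  have hsw : a + 1 < w := by
    by_contra! hlt
    rcases Nat.eq_zero_or_pos w with rfl | hw0
    · omega
    · rcases hlt.eq_or_lt with rfl | hlt
      · omega
      · have := small w hw0 hlt
        omega
  have large : ∀ l, a + 1 ≤ l → l < w → b < f l := by
    intro l hl hlw
    have h1 := pos_of_lt l (by omega)
    have h2 := hf.inj l (by omega) 0 hn0
    have h3 := hf.inj l (by omega) w hw
    have h4 := h.avoids_321 0 l w (by omega) hlw hw
    omega
  have incr : ∀ l k, a + 1 ≤ l → l < k → k < w → f l < f k := by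
    intro l k hl hlk hkw
    have h1 := h.avoids_321 l k w hlk hkw hw
    have h2 := hf.inj l (by omega) k (by omega)
    have h3 := large k (by omega) hkw
    omega
  obtain ⟨e, rfl⟩ : ∃ e, w = e + 1 := ⟨w - 1, by omega⟩
  have mid : ∀ l, a + 1 ≤ l → l < e → f l + a = b + l := by
    intro l
    induction l using Nat.strong_induction_on with
    | _ l ih =>
    intro hl hle
    have hbl := large l hl (by omega)
    have hlt := incr l (l + 1) hl (by omega) (by omega)
    obtain ⟨u, hu, hfu⟩ := hf.surj (f l - 1) (by have := hf.lt l (by omega); omega)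
    have hul : u < l := by
      have h1 := h.fishburn l u
      by_contra! hul
      rcases hul.eq_or_lt with rfl | hul
      · omega
      · rcases (Nat.succ_le_of_lt hul).eq_or_lt with rfl | hul
        · rw [Nat.succ_eq_add_one] at hfu
          omega
        · exact h1 hul hu hlt (by omega)
    rcases Nat.eq_zero_or_pos u with rfl | hu0
    · rcases hl.eq_or_lt with rfl | hl
      · omega
      · have := ih (a + 1) hl le_rfl (by omega)
        have := hf.inj l (by omega) (a + 1) (by omega)
        omega
    · have hau : a + 1 ≤ u := by
        by_contra! hua
        have := hsmin u hua
        have := hf.inj u hu 0 hn0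
        omega
      have := ih u hul hau (by omega)
      have := ih (u + 1)
      have := hf.inj l (by omega) (u + 1) (by omega)
      by_cases hul' : u + 1 = l <;> omega
  obtain ⟨M, hM⟩ : ∃ M, M = f e := ⟨_, rfl⟩
  have hMn : M < n := hM ▸ hf.lt e (by omega)
  have hbM : b < M := hM ▸ large e (by omega) (by omega)
  obtain ⟨c, hc⟩ : ∃ c, c + a = b + e := ⟨b + e - a, by omega⟩
  have hcM : c ≤ M := by
    by_contra! hlt
    have := mid (M + a - b) (by omega) (by omega)
    have := hf.inj e (by omega) (M + a - b) (by omega)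
    omega
  have hwt : e + 1 ≤ t := by
    have := large t
    omega
  have late : ∀ l, e + 1 ≤ l → l ≤ t → f l < b := by
    intro l hl hlt
    by_contra! hbl
    have h1 := hf.inj l (by omega) 0 hn0
    have h2 := hf.inj l (by omega) e (by omega)
    have h3 := hf.inj (e + 1) hw t ht
    have hwl : e + 1 ≠ l := by rintro rfl; omega
    have hlt' : l ≠ t := by rintro rfl; omega
    have h4 := h.avoids_321 e l t (by omega) (by omega) ht
    have h5 := h.avoids_14253 1 e (e + 1) l t (by omega) (by omega) (by omega) (by omega) ht
    omega
  have rest : ∀ l, e + 1 ≤ l → l ≤ t → f l + e + 1 = a + l := by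
    intro l
    induction l using Nat.strong_induction_on with
    | _ l ih =>
    intro hl hlt
    have hlb := late l hl hlt
    have hla := pos_of_lt l (by omega)
    have hle : a + l ≤ f l + e + 1 := by
      by_contra! hlt
      have := ih (f l + e + 1 - a) (by omega) (by omega) (by omega)
      have := hf.inj l (by omega) (f l + e + 1 - a) (by omega)
      omega
    obtain ⟨u, hu, hfu⟩ := hf.surj (a + l - e - 1) (by omega)
    rcases lt_trichotomy u l with hul | rfl | hul
    · rcases Nat.eq_zero_or_pos u with rfl | hu0
      · omega
      · have := small u hu0
        have := large u
        have := ih u hul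
        omega
    · omega
    · have := h.avoids_321 0 l u (by omega) hul hu
      have := hf.inj l (by omega) u hu
      omega
  have htc : t = c := by
    have := rest t hwt le_rfl
    omega
  subst htc
  have tail_ge : ∀ l, t < l → l < n → t ≤ f l := by
    intro l hl hln
    by_contra! hlt
    have h1 := pos_of_lt l hln
    have h2 := hf.inj l hln 0 hn0
    by_cases hfb : f l < b
    · have := rest (f l + e + 1 - a) (by omega) (by omega)
      have := hf.inj l hln (f l + e + 1 - a) (by omega)
      omega
    · have := mid (f l + a - b) (by omega) (by omega)
      have := hf.inj l hln (f l + a - b) (by omega)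
      omega
  have head_lt : ∀ u, u ≤ t → f u < t ∨ f u = M := by
    intro u hu
    rcases Nat.eq_zero_or_pos u with rfl | hu0
    · omega
    · have := small u hu0
      have := mid u
      have := rest u
      have : u = e → f u = M := by rintro rfl; exact hM.symm
      omega
  have block_end : ∀ l, t < l → l ≤ M → f l = l - 1 := by
    intro l
    induction l using Nat.strong_induction_on with
    | _ l ih =>
    intro hl hlM
    have hge := tail_ge l hl (by omega)
    have hle : l - 1 ≤ f l := by
      by_contra! hlt
      have := ih (f l + 1) (by omega) (by omega) (by omega)
      have := hf.inj l (by omega) (f l + 1) (by omega)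
      omega
    obtain ⟨u, hu, hfu⟩ := hf.surj (l - 1) (by omega)
    rcases lt_trichotomy u l with hul | rfl | hul
    · have := head_lt u
      have := ih u hul
      omega
    · exact hfu
    · have h1 := hf.inj l (by omega) u hu
      have h2 := hf.inj l (by omega) e (by omega)
      have h4 := h.avoids_321 e l u (by omega) hul hu
      have h5 := h.avoids_14253 1 e (e + 1) l u (by omega) (by omega) (by omega) hul hu
      omega
  have tail_low : ∀ l, t + 1 ≤ l → l < n → l ≤ f l + 1 := by
    intro l hl hln
    by_contra! hlt
    have := (key l hln (by omega)).1
    have := tail_ge l (by omega) hln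
    omega
  let S := (Finset.Ioo 0 n).filter fun i => i = a ∨ i = b ∨ i = t ∨ t < i ∧ i ≤ f i
  have mem_S : ∀ i, i ∈ S ↔ (0 < i ∧ i < n) ∧ (i = a ∨ i = b ∨ i = t ∨ t < i ∧ i ≤ f i) := by
    intro i
    simp only [S, Finset.mem_filter, Finset.mem_Ioo]
  have hSt : StartsWith n S a b t := by
    refine ⟨Finset.filter_subset _ _, by omega, by omega, by omega, ht, fun i hi => ?_⟩
    rw [mem_S]
    omega
  have hnext : nextIn n S t = M + 1 := by
    refine nextIn_eq (by omega) (by omega) ?_ fun j hj hjM => ?_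
    · rw [mem_S]
      by_cases hMn' : M + 1 < n
      · have := tail_low (M + 1) (by omega) hMn'
        have := hf.inj (M + 1) hMn' e (by omega)
        omega
      · omega
    · rw [mem_S]
      have := block_end j hj (by omega)
      omega
  have htail := hf.eq_layered (S := S) tail_low fun i hi hin _ => by rw [mem_S]; omega
  refine ⟨S, a, b, t, hSt, fun i hi => ?_⟩
  rw [hSt.twisted_eq]
  split_ifs with c1 c2 c3 c4 c5
  · rw [c1, hb]
  · exact small i (by omega) (by omega)
  · have := mid i (by omega) (by omega)
    omega
  · rw [hnext, show i = e by omega]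
    omega
  · have := rest i (by omega) c5
    omega
  · exact htail i (by omega) hi

theorem ncard_not_layered (n : ℕ) :
    {π : Equiv.Perm (Fin n) | IsAdmissible n (oneLine π) ∧
      ∃ i < n, ¬ i ≤ oneLine π i + 1}.ncard =
      ((Finset.Ioo 0 n).powerset.filter fun S => 3 ≤ S.card).card := by
  have startsWith : ∀ S ∈ (Finset.Ioo 0 n).powerset.filter (fun S => 3 ≤ S.card),
      ∃ a b c, StartsWith n S a b c := by
    intro S hS
    rw [Finset.mem_filter, Finset.mem_powerset] at hS
    exact StartsWith.of_card hS.1 hS.2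
  refine ncard_perm_eq_card (fun f => IsAdmissible n f ∧ ∃ i < n, ¬ i ≤ f i + 1) _
    (twisted n) ?_ ?_ ?_ ?_ ?_ ?_
  · rintro f g h ⟨hg, i, hi, hgi⟩
    exact ⟨hg.congr h, i, hi, by rwa [h i hi]⟩
  · intro S hS i hi
    obtain ⟨a, b, c, h⟩ := startsWith S hS
    exact h.twisted_lt hi
  · intro S hS i hi j hj
    obtain ⟨a, b, c, h⟩ := startsWith S hS
    exact h.twisted_injOn hi hj
  · intro S hS
    obtain ⟨a, b, c, h⟩ := startsWith S hS
    exact ⟨h.isAdmissible_twisted, h.exists_not_layered⟩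
  · rintro f hf ⟨h, i, hi, hfi⟩
    obtain ⟨S, a, b, c, hS, heq⟩ := h.exists_eq_twisted hf hi (by omega)
    exact ⟨S, Finset.mem_filter.2 ⟨Finset.mem_powerset.2 hS.subset, hS.three_le_card⟩, heq⟩
  · intro S hS T hT heq
    obtain ⟨a, b, c, h⟩ := startsWith S hS
    obtain ⟨a', b', c', h'⟩ := startsWith T hT
    exact h.eq_of_twisted_eq h' heq

theorem card_filter_three_le_card_powerset {α : Type*} [DecidableEq α] (s : Finset α) :
    (s.powerset.filter fun t => 3 ≤ t.card).card + (1 + s.card + s.card.choose 2) =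
      2 ^ s.card := by
  have hsplit := Finset.card_filter_add_card_filter_not (s := s.powerset) fun t => 3 ≤ t.card
  have hsmall : (s.powerset.filter fun t => ¬ 3 ≤ t.card) =
      (s.powersetCard 0 ∪ s.powersetCard 1) ∪ s.powersetCard 2 := by
    ext t
    simp only [Finset.mem_filter, Finset.mem_powerset, Finset.mem_union, Finset.mem_powersetCard]
    by_cases hts : t ⊆ s
    · simp only [hts, true_and]
      omega
    · simp only [hts, false_and, or_self]
  rw [hsmall, Finset.card_union_of_disjoint, Finset.card_union_of_disjoint,
    Finset.card_powersetCard, Finset.card_powersetCard, Finset.card_powersetCard,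
    Finset.card_powerset, Nat.choose_zero_right, Nat.choose_one_right] at hsplit
  · exact hsplit
  · exact Finset.pairwise_disjoint_powersetCard s (by decide : (0 : ℕ) ≠ 1)
  · rw [Finset.disjoint_union_left]
    exact ⟨Finset.pairwise_disjoint_powersetCard s (by decide : (0 : ℕ) ≠ 2),
      Finset.pairwise_disjoint_powersetCard s (by decide : (1 : ℕ) ≠ 2)⟩

theorem fishburn_321_14253 (n : ℕ) (hn : 1 ≤ n) :
    ({π : Equiv.Perm (Fin n) | IsFishburn π ∧ Avoids π ![3, 2, 1] ∧ Avoids π ![1, 4, 2, 5, 3]}.ncard : ℤ) = 2 ^ n - n.choose 2 - 1 := by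
  have hunion : {π : Equiv.Perm (Fin n) |
      IsFishburn π ∧ Avoids π ![3, 2, 1] ∧ Avoids π ![1, 4, 2, 5, 3]} =
      {π | IsAdmissible n (oneLine π) ∧ ∀ i < n, i ≤ oneLine π i + 1} ∪
      {π | IsAdmissible n (oneLine π) ∧ ∃ i < n, ¬ i ≤ oneLine π i + 1} := by
    ext π
    simp only [Set.mem_union, Set.mem_ofPred_eq, ← isAdmissible_oneLine_iff]
    grind
  rw [hunion, Set.ncard_union_eq, ncard_layered, ncard_not_layered]
  · have hcard := card_filter_three_le_card_powerset (Finset.Ioo 0 n)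
    rw [Nat.card_Ioo, Nat.sub_zero] at hcard
    obtain ⟨m, rfl⟩ : ∃ m, n = m + 1 := ⟨n - 1, by omega⟩
    rw [Nat.choose_succ_succ' m 1, Nat.choose_one_right, pow_succ]
    rw [Nat.add_sub_cancel] at hcard ⊢
    generalize Finset.card _ = k at hcard ⊢
    zify at hcard
    push_cast
    linarith
  · rw [Set.disjoint_left]
    rintro π ⟨-, h⟩ ⟨-, i, hi, hfi⟩
    exact hfi (h i hi)
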